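/- Let g_1, …, g_n ∈ ℝ^d with ‖g_i‖_2 ≤ Δ_2 for all i, let γ ∈ (0,1], let s_1, …, s_n be independent random vectors in {0,1}^d with i.i.d. Bernoulli(γ) coordinates, and let Z be an independent random vector in ℝ^d with i.i.d. N(0,σ²) coordinates. Define μ̂ = (1/(nγ)) · ( Σ_{i=1}^n g_i ⊙ s_i + Z ) and μ = (1/n) Σ_{i=1}^n g_i, where ⊙ denotes the coordinatewise product. Then the mean squared error of the sparsified Gaussian mean estimator satisfies E[ ‖μ̂ − μ‖_2² ] ≤ d·σ²/(n²γ²) + Δ_2²/(nγ). -/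

import Mathlib

open MeasureTheory ProbabilityTheory Real
open scoped ENNReal NNReal Classical

/-- Rényi divergence of order `a` between measures `μ` and `ν`:
`(a-1)⁻¹ * log ∫ (dμ/dν)^a dν`, set to `⊤` when `μ` is not absolutely
continuous with respect to `ν`. -/
noncomputable def renyiDiv {E : Type*} [MeasurableSpace E] (a : ℝ) (μ ν : Measure E) : EReal :=
  if μ ≪ ν then (((a - 1)⁻¹ : ℝ) : EReal) * ENNReal.log (∫⁻ x, (μ.rnDeriv ν x) ^ a ∂ν)
  else ⊤

/-- Bernoulli(γ) distribution on ℝ, supported on {0, 1}. -/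
noncomputable def bern (γ : ℝ) : Measure ℝ :=
  ENNReal.ofReal γ • Measure.dirac 1 + ENNReal.ofReal (1 - γ) • Measure.dirac 0

lemma bern_prob (γ : ℝ) (h0 : 0 < γ) (h1 : γ ≤ 1) : IsProbabilityMeasure (bern γ) := by
  constructor
  simp only [bern, Measure.add_apply, Measure.smul_apply, measure_univ, smul_eq_mul, mul_one]
  rw [← ENNReal.ofReal_add h0.le (by linarith)]
  simp

lemma bern_integral (γ : ℝ) (h0 : 0 < γ) (h1 : γ ≤ 1) (f : ℝ → ℝ) :
    ∫ x, f x ∂(bern γ) = γ * f 1 + (1 - γ) * f 0 := by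
  have h (a : ℝ) (r : ℝ) : Integrable f (ENNReal.ofReal r • Measure.dirac a) :=
    (integrable_dirac (by simp)).smul_measure (by simp)
  rw [bern, integral_add_measure (h _ _) (h _ _), integral_smul_measure, integral_smul_measure,
    integral_dirac, integral_dirac, ENNReal.toReal_ofReal h0.le,
    ENNReal.toReal_ofReal (by linarith)]
  simp

lemma bern_memLp (γ : ℝ) (f : ℝ → ℝ) (hf : Measurable f) : MemLp f 2 (bern γ) := by
  rw [memLp_two_iff_integrable_sq hf.aestronglyMeasurable]
  have h (a : ℝ) (r : ℝ) : Integrable (fun x => f x ^ 2) (ENNReal.ofReal r • Measure.dirac a) :=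
    (integrable_dirac (by simp)).smul_measure (by simp)
  exact (h _ _).add_measure (h _ _)

lemma mp_integral {A B : Type*} [MeasurableSpace A] [MeasurableSpace B] {μ : Measure A}
    {ν : Measure B} {T : A → B} (hT : MeasurePreserving T μ ν) {f : B → ℝ} (hf : Measurable f) :
    ∫ x, f (T x) ∂μ = ∫ y, f y ∂ν := by
  rw [← hT.map_eq, integral_map hT.measurable.aemeasurable hf.aestronglyMeasurable]

lemma coord_mse (γ : ℝ) (hγ0 : 0 < γ) (hγ1 : γ ≤ 1) (v : ℝ≥0)
    (d n : ℕ) (g : Fin n → ℝ) (j : Fin d)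
    (P : Measure ((Fin n → Fin d → ℝ) × (Fin d → ℝ)))
    (hP : P = (Measure.pi fun _ : Fin n => Measure.pi fun _ : Fin d => bern γ).prod
        (Measure.pi fun _ : Fin d => gaussianReal 0 v)) :
    Integrable (fun ω => ((∑ i, g i * (ω.1 i j - γ)) + ω.2 j) ^ 2) P ∧
    ∫ ω, ((∑ i, g i * (ω.1 i j - γ)) + ω.2 j) ^ 2 ∂P = (∑ i, g i ^ 2) * (γ * (1 - γ)) + v := by
  have := bern_prob γ hγ0 hγ1
  have e1 : MeasurePreserving (fun t : Fin d → ℝ => t j)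
      (Measure.pi fun _ : Fin d => bern γ) (bern γ) := measurePreserving_eval _ j
  have e2 : MeasurePreserving (fun t : Fin d → ℝ => t j)
      (Measure.pi fun _ : Fin d => gaussianReal 0 v) (gaussianReal 0 v) :=
    measurePreserving_eval _ j
  have e3 (i : Fin n) : MeasurePreserving (fun t : Fin n → Fin d → ℝ => t i)
      (Measure.pi fun _ : Fin n => Measure.pi fun _ : Fin d => bern γ)
      (Measure.pi fun _ : Fin d => bern γ) :=
    measurePreserving_eval (fun _ : Fin n => Measure.pi fun _ : Fin d => bern γ) i
  have hX (i : Fin n) : MemLp (fun t : Fin d → ℝ => g i * (t j - γ)) 2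
      (Measure.pi fun _ : Fin d => bern γ) :=
    (bern_memLp γ (fun x => g i * (x - γ)) (by fun_prop)).comp_measurePreserving e1
  have hA : MemLp (fun t : Fin n → Fin d → ℝ => ∑ i, g i * (t i j - γ)) 2
      (Measure.pi fun _ : Fin n => Measure.pi fun _ : Fin d => bern γ) :=
    memLp_finsetSum _ fun i _ => (hX i).comp_measurePreserving (e3 i)
  have hZ : MemLp (fun t : Fin d → ℝ => t j) 2
      (Measure.pi fun _ : Fin d => gaussianReal 0 v) :=
    (memLp_id_gaussianReal' 2 (by simp)).comp_measurePreserving e2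
  have hvA := variance_sum_pi hX
  have hv := variance_add_prod hA hZ
  have hsum : (∑ i, fun ω : Fin n → Fin d → ℝ => g i * (ω i j - γ))
      = fun t : Fin n → Fin d → ℝ => ∑ i, g i * (t i j - γ) := by
    ext t; simp
  rw [hsum] at hvA
  have hmX (i : Fin n) : ∫ t : Fin d → ℝ, g i * (t j - γ) ∂(Measure.pi fun _ : Fin d => bern γ)
      = 0 := by
    rw [mp_integral e1 (f := fun x => g i * (x - γ)) (by fun_prop), bern_integral γ hγ0 hγ1]
    ring
  have hvX (i : Fin n) : Var[fun t : Fin d → ℝ => g i * (t j - γ);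
      Measure.pi fun _ : Fin d => bern γ] = g i ^ 2 * (γ * (1 - γ)) := by
    rw [variance_of_integral_eq_zero (hX i).aemeasurable (hmX i),
      mp_integral e1 (f := fun x => (g i * (x - γ)) ^ 2) (by fun_prop), bern_integral γ hγ0 hγ1]
    ring
  have hvZ : Var[fun t : Fin d → ℝ => t j; Measure.pi fun _ : Fin d => gaussianReal 0 v] = v := by
    rw [e2.variance_fun_comp (f := fun x => x) (by fun_prop), variance_fun_id_gaussianReal]
  have hL : MemLp (fun ω : (Fin n → Fin d → ℝ) × (Fin d → ℝ) =>
      (∑ i, g i * (ω.1 i j - γ)) + ω.2 j) 2 P := by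
    rw [hP]
    exact (hA.comp_fst _).add (hZ.comp_snd _)
  refine ⟨hL.integrable_sq, ?_⟩
  have hm : ∫ ω, ((∑ i, g i * (ω.1 i j - γ)) + ω.2 j) ∂P = 0 := by
    rw [hP, integral_add (((hA.comp_fst _)).integrable one_le_two)
      ((hZ.comp_snd _).integrable one_le_two),
      mp_integral measurePreserving_fst
        (f := fun t : Fin n → Fin d → ℝ => ∑ i, g i * (t i j - γ)) (by fun_prop),
      mp_integral measurePreserving_snd (f := fun t : Fin d → ℝ => t j) (by fun_prop),
      mp_integral e2 (f := fun x => x) (by fun_prop), integral_id_gaussianReal]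
    have hI (i : Fin n) : Integrable (fun t : Fin n → Fin d → ℝ => g i * (t i j - γ))
        (Measure.pi fun _ : Fin n => Measure.pi fun _ : Fin d => bern γ) :=
      ((hX i).comp_measurePreserving (e3 i)).integrable one_le_two
    rw [add_zero, integral_finsetSum _ fun i _ => hI i]
    refine Finset.sum_eq_zero fun i _ => ?_
    rw [mp_integral (e3 i) (f := fun t : Fin d → ℝ => g i * (t j - γ)) (by fun_prop), hmX]
  rw [← variance_of_integral_eq_zero hL.aemeasurable hm, hP, hv, hvA, hvZ, Finset.sum_mul]
  simp_rw [hvX]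

theorem csgm_estimator_mse_le
    (σ γ Δ₂ : ℝ) (hγ0 : 0 < γ) (hγ1 : γ ≤ 1)
    (d n : ℕ) (hn : 0 < n) (g : Fin n → Fin d → ℝ)
    (hg2 : ∀ i, Real.sqrt (∑ j, g i j ^ 2) ≤ Δ₂)
    (P : Measure ((Fin n → Fin d → ℝ) × (Fin d → ℝ)))
    (hP : P = (Measure.pi fun _ : Fin n => Measure.pi fun _ : Fin d => bern γ).prod
        (Measure.pi fun _ : Fin d => gaussianReal 0 (Real.toNNReal (σ ^ 2))))
    (μhat : (Fin n → Fin d → ℝ) × (Fin d → ℝ) → Fin d → ℝ)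
    (hμhat : ∀ ω j, μhat ω j = (1 / (n * γ)) * ((∑ i, g i j * ω.1 i j) + ω.2 j))
    (μbar : Fin d → ℝ) (hμbar : ∀ j, μbar j = (1 / (n : ℝ)) * ∑ i, g i j) :
    ∫ ω, ∑ j, (μhat ω j - μbar j) ^ 2 ∂P ≤
      d * σ ^ 2 / (n ^ 2 * γ ^ 2) + Δ₂ ^ 2 / (n * γ) := by
  have hn' : (0 : ℝ) < n := by exact_mod_cast hn
  have hc := fun j => coord_mse γ hγ0 hγ1 (Real.toNNReal (σ ^ 2)) d n (fun i => g i j) j P hP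
  have hpt : ∀ ω : (Fin n → Fin d → ℝ) × (Fin d → ℝ), ∀ j, (μhat ω j - μbar j) ^ 2
      = (1 / (n * γ)) ^ 2 * ((∑ i, g i j * (ω.1 i j - γ)) + ω.2 j) ^ 2 := by
    intro ω j
    rw [hμhat, hμbar, ← mul_pow]
    congr 1
    simp_rw [mul_sub]
    rw [Finset.sum_sub_distrib, ← Finset.sum_mul]
    field_simp
    ring
  simp_rw [hpt]
  rw [integral_finsetSum _ fun j _ => (hc j).1.const_mul _]
  simp_rw [integral_const_mul, (hc _).2, Real.coe_toNNReal _ (sq_nonneg σ)]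
  rw [← Finset.mul_sum, Finset.sum_add_distrib, ← Finset.sum_mul, Finset.sum_comm]
  have hG : ∑ i, ∑ j, g i j ^ 2 ≤ n * Δ₂ ^ 2 := by
    calc ∑ i, ∑ j, g i j ^ 2 ≤ ∑ i : Fin n, Δ₂ ^ 2 := by
          refine Finset.sum_le_sum fun i _ => ?_
          exact (Real.sqrt_le_left ((Real.sqrt_nonneg _).trans (hg2 i))).1 (hg2 i)
      _ = n * Δ₂ ^ 2 := by simp
  have h2 : (∑ i, ∑ j, g i j ^ 2) * (γ * (1 - γ)) ≤ n * Δ₂ ^ 2 * γ := by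
    have h3 : γ * (1 - γ) ≤ γ := by nlinarith
    have h4 : 0 ≤ γ * (1 - γ) := mul_nonneg hγ0.le (by linarith)
    exact mul_le_mul hG h3 h4 (by positivity)
  calc _ ≤ (1 / (n * γ)) ^ 2 * (n * Δ₂ ^ 2 * γ + d * σ ^ 2) := by
        refine mul_le_mul_of_nonneg_left ?_ (by positivity)
        refine add_le_add h2 ?_
        simp
    _ = _ := by
        field_simp
        ring
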